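/- For every a ∈ {1,…,N} there exists a unique k-linear map ∂_a : 𝒟 → 𝒟 such that ∂_a(D_b) = 1 if b = a, ∂_a(D_b) = 0 if b ≠ a, and ∂_a(p·q) = ∂_a(p)·q + ν_a(p)·∂_a(q) for all p, q ∈ 𝒟. -/

import Mathlib

/-!
The diffusion algebra of type `C` on `N` generators over a field `k`, with
`I = {i0}` and `S = {1,…,N} \ {i0}`, and common coefficient `G` (denoted `𝒢`
in the paper).  It is the quotient of the free associative unital `k`-algebra
on generators `D_1, …, D_N` by the two-sided ideal generated by the elements
`G·D_{i0}·D_s − (G − Λ)·D_s·D_{i0} + x·D_s` for `s ∈ S` and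
`D_s·D_l − D_l·D_s` for `s, l ∈ S`.
-/

noncomputable section

namespace DiffusionC

open FreeAlgebra

variable (k : Type*) [Field k] (N : ℕ) (i0 : Fin N) (Λ x G : k)

/-- The defining relations of the type `C` diffusion algebra. -/
def rel : FreeAlgebra k (Fin N) → FreeAlgebra k (Fin N) → Prop := fun a b =>
  (∃ s : Fin N, s ≠ i0 ∧
      a = G • (ι k i0 * ι k s) ∧
      b = (G - Λ) • (ι k s * ι k i0) - x • ι k s) ∨
  (∃ s l : Fin N, s ≠ i0 ∧ l ≠ i0 ∧
      a = ι k s * ι k l ∧ b = ι k l * ι k s)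

/-- The diffusion algebra `𝒟` of type `C`. -/
abbrev Diff := RingQuot (rel k N i0 Λ x G)

/-- The images of the generators `D_i` in `𝒟`. -/
def D (i : Fin N) : Diff k N i0 Λ x G :=
  RingQuot.mkAlgHom k (rel k N i0 Λ x G) (ι k i)

/-- The defining property of the endomorphism `ν_{i0}` of `𝒟`:
`ν_{i0}(D_{i0}) = D_{i0}` and `ν_{i0}(D_s) = 𝒢·(𝒢 − Λ)⁻¹·D_s` for `s ∈ S`. -/
def IsNuI0 (ν : Diff k N i0 Λ x G →ₐ[k] Diff k N i0 Λ x G) : Prop :=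
  ν (D k N i0 Λ x G i0) = D k N i0 Λ x G i0 ∧
  ∀ s : Fin N, s ≠ i0 →
    ν (D k N i0 Λ x G s) = (G * (G - Λ)⁻¹) • D k N i0 Λ x G s

/-- The defining property of the endomorphism `ν_s` of `𝒟` (`s ∈ S`):
`ν_s(D_{i0}) = 𝒢⁻¹·((𝒢 − Λ)·D_{i0} − x)` and `ν_s(D_l) = D_l` for `l ∈ S`. -/
def IsNuS (s : Fin N) (ν : Diff k N i0 Λ x G →ₐ[k] Diff k N i0 Λ x G) : Prop :=
  ν (D k N i0 Λ x G i0) = G⁻¹ • ((G - Λ) • D k N i0 Λ x G i0 - x • 1) ∧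
  ∀ l : Fin N, l ≠ i0 → ν (D k N i0 Λ x G l) = D k N i0 Λ x G l

/-- `ν_a` is `ν_{i0}` for `a = i0` and `ν_a` for `a ∈ S`. -/
def IsNu (a : Fin N) (ν : Diff k N i0 Λ x G →ₐ[k] Diff k N i0 Λ x G) : Prop :=
  if a = i0 then IsNuI0 k N i0 Λ x G ν else IsNuS k N i0 Λ x G a ν

/-- The defining property of the twisted partial derivative `∂_a : 𝒟 → 𝒟`
(relative to `ν = ν_a`): it is `k`-linear, `∂_a(D_b) = δ_{ab}·1`, and
`∂_a(p·q) = ∂_a(p)·q + ν_a(p)·∂_a(q)` for all `p, q ∈ 𝒟`. -/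
def IsPartial (a : Fin N) (ν : Diff k N i0 Λ x G →ₐ[k] Diff k N i0 Λ x G)
    (pd : Diff k N i0 Λ x G →ₗ[k] Diff k N i0 Λ x G) : Prop :=
  (∀ b : Fin N, pd (D k N i0 Λ x G b) = if b = a then 1 else 0) ∧
  ∀ p q : Diff k N i0 Λ x G, pd (p * q) = pd p * q + ν p * pd q

theorem diff_induction {P : Diff k N i0 Λ x G → Prop}
    (hc : ∀ r : k, P (algebraMap k _ r)) (hD : ∀ i, P (D k N i0 Λ x G i))
    (hm : ∀ p q, P p → P q → P (p * q)) (ha : ∀ p q, P p → P q → P (p + q)) :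
    ∀ p, P p := by
  intro p
  obtain ⟨f, rfl⟩ := RingQuot.mkAlgHom_surjective k (rel k N i0 Λ x G) p
  induction f using FreeAlgebra.induction with
  | grade0 r => rw [AlgHom.commutes]; exact hc r
  | grade1 i => exact hD i
  | mul a b h1 h2 => rw [map_mul]; exact hm _ _ h1 h2
  | add a b h1 h2 => rw [map_add]; exact ha _ _ h1 h2

theorem D_rel1 (s : Fin N) (hs : s ≠ i0) :
    G • (D k N i0 Λ x G i0 * D k N i0 Λ x G s) =
      (G - Λ) • (D k N i0 Λ x G s * D k N i0 Λ x G i0) - x • D k N i0 Λ x G s := by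
  have h := RingQuot.mkAlgHom_rel k (s := rel k N i0 Λ x G) (Or.inl ⟨s, hs, rfl, rfl⟩)
  simp only [map_smul, map_mul, map_sub] at h
  exact h

theorem D_rel2 (s l : Fin N) (hs : s ≠ i0) (hl : l ≠ i0) :
    D k N i0 Λ x G s * D k N i0 Λ x G l = D k N i0 Λ x G l * D k N i0 Λ x G s := by
  have h := RingQuot.mkAlgHom_rel k (s := rel k N i0 Λ x G) (Or.inr ⟨s, l, hs, hl, rfl, rfl⟩)
  simp only [map_mul] at h
  exact h

/-- The upper triangular matrix attached to a generator. -/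
def mat (a : Fin N) (ν : Diff k N i0 Λ x G →ₐ[k] Diff k N i0 Λ x G) (b : Fin N) :
    Matrix (Fin 2) (Fin 2) (Diff k N i0 Λ x G) :=
  !![ν (D k N i0 Λ x G b), if b = a then 1 else 0; 0, D k N i0 Λ x G b]

theorem mat00 (a b : Fin N) (ν : Diff k N i0 Λ x G →ₐ[k] Diff k N i0 Λ x G) :
    mat k N i0 Λ x G a ν b 0 0 = ν (D k N i0 Λ x G b) := rfl

theorem mat01 (a b : Fin N) (ν : Diff k N i0 Λ x G →ₐ[k] Diff k N i0 Λ x G) :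
    mat k N i0 Λ x G a ν b 0 1 = if b = a then 1 else 0 := rfl

theorem mat10 (a b : Fin N) (ν : Diff k N i0 Λ x G →ₐ[k] Diff k N i0 Λ x G) :
    mat k N i0 Λ x G a ν b 1 0 = 0 := rfl

theorem mat11 (a b : Fin N) (ν : Diff k N i0 Λ x G →ₐ[k] Diff k N i0 Λ x G) :
    mat k N i0 Λ x G a ν b 1 1 = D k N i0 Λ x G b := rfl

theorem mat_rel1 (hG0 : G ≠ 0) (hGΛ : G ≠ Λ) (a : Fin N)
    (ν : Diff k N i0 Λ x G →ₐ[k] Diff k N i0 Λ x G) (hν : IsNu k N i0 Λ x G a ν)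
    (s : Fin N) (hs : s ≠ i0) :
    G • (mat k N i0 Λ x G a ν i0 * mat k N i0 Λ x G a ν s) =
      (G - Λ) • (mat k N i0 Λ x G a ν s * mat k N i0 Λ x G a ν i0)
        - x • mat k N i0 Λ x G a ν s := by
  have h1 := D_rel1 k N i0 Λ x G s hs
  have h2 := congrArg ν h1
  simp only [map_smul, map_mul, map_sub] at h2
  have hd : G - Λ ≠ 0 := sub_ne_zero.mpr hGΛ
  have h3 : G • ((if i0 = a then 1 else 0) * D k N i0 Λ x G s
        + ν (D k N i0 Λ x G i0) * (if s = a then 1 else 0)) =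
      (G - Λ) • ((if s = a then 1 else 0) * D k N i0 Λ x G i0
        + ν (D k N i0 Λ x G s) * (if i0 = a then 1 else 0))
        - x • (if s = a then 1 else 0 : Diff k N i0 Λ x G) := by
    unfold IsNu at hν
    split_ifs at hν with ha
    · subst ha
      rw [hν.2 s hs]
      simp only [if_true, if_neg hs, one_mul, mul_zero, add_zero, zero_mul, zero_add, mul_one,
        smul_zero, sub_zero, smul_smul]
      congr 1
      field_simp
    · rw [hν.1, if_neg (Ne.symm ha)]
      by_cases hsa : s = a
      · simp only [if_pos hsa, zero_mul, zero_add, mul_one, one_mul, mul_zero, add_zero]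
        rw [smul_inv_smul₀ hG0]
      · simp [if_neg hsa]
  refine Matrix.ext (Fin.forall_fin_two.2
    ⟨Fin.forall_fin_two.2 ⟨?_, ?_⟩, Fin.forall_fin_two.2 ⟨?_, ?_⟩⟩)
  all_goals simp only [Matrix.mul_apply, Fin.sum_univ_two, Matrix.smul_apply, Matrix.sub_apply,
    mat00, mat01, mat10, mat11, mul_zero, zero_mul, add_zero, zero_add, smul_zero, sub_zero]
  · exact h2
  · rw [add_comm, add_comm (_ * D k N i0 Λ x G i0)] at h3
    exact h3
  · exact h1

theorem mat_rel2 (a : Fin N)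
    (ν : Diff k N i0 Λ x G →ₐ[k] Diff k N i0 Λ x G) (hν : IsNu k N i0 Λ x G a ν)
    (s l : Fin N) (hs : s ≠ i0) (hl : l ≠ i0) :
    mat k N i0 Λ x G a ν s * mat k N i0 Λ x G a ν l =
      mat k N i0 Λ x G a ν l * mat k N i0 Λ x G a ν s := by
  have h1 := D_rel2 k N i0 Λ x G s l hs hl
  have h2 := congrArg ν h1
  simp only [map_mul] at h2
  have h3 : ν (D k N i0 Λ x G s) * (if l = a then 1 else 0)
        + (if s = a then 1 else 0) * D k N i0 Λ x G l =
      ν (D k N i0 Λ x G l) * (if s = a then 1 else 0)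
        + (if l = a then 1 else 0) * D k N i0 Λ x G s := by
    unfold IsNu at hν
    split_ifs at hν with ha
    · subst ha
      simp [hs, hl]
    · rw [hν.2 s hs, hν.2 l hl]
      by_cases h : s = a <;> by_cases h' : l = a <;> simp [h, h']
  refine Matrix.ext (Fin.forall_fin_two.2
    ⟨Fin.forall_fin_two.2 ⟨?_, ?_⟩, Fin.forall_fin_two.2 ⟨?_, ?_⟩⟩)
  all_goals simp only [Matrix.mul_apply, Fin.sum_univ_two, Matrix.smul_apply, Matrix.sub_apply,
    mat00, mat01, mat10, mat11, mul_zero, zero_mul, add_zero, zero_add, smul_zero, sub_zero]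
  · exact h2
  · exact h3
  · exact h1

theorem exists_hom (hG0 : G ≠ 0) (hGΛ : G ≠ Λ) (a : Fin N)
    (ν : Diff k N i0 Λ x G →ₐ[k] Diff k N i0 Λ x G) (hν : IsNu k N i0 Λ x G a ν) :
    ∃ φ : Diff k N i0 Λ x G →ₐ[k] Matrix (Fin 2) (Fin 2) (Diff k N i0 Λ x G),
      ∀ b, φ (D k N i0 Λ x G b) = mat k N i0 Λ x G a ν b := by
  refine ⟨RingQuot.liftAlgHom k ⟨FreeAlgebra.lift k (mat k N i0 Λ x G a ν), ?_⟩, ?_⟩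
  · rintro p q (⟨s, hs, rfl, rfl⟩ | ⟨s, l, hs, hl, rfl, rfl⟩)
    · simp only [map_smul, map_mul, map_sub, FreeAlgebra.lift_ι_apply]
      exact mat_rel1 k N i0 Λ x G hG0 hGΛ a ν hν s hs
    · simp only [map_mul, FreeAlgebra.lift_ι_apply]
      exact mat_rel2 k N i0 Λ x G a ν hν s l hs hl
  · intro b
    rw [D, RingQuot.liftAlgHom_mkAlgHom_apply, FreeAlgebra.lift_ι_apply]

/-- For every `a ∈ {1,…,N}` there exists a unique `k`-linear
map `∂_a : 𝒟 → 𝒟` with `∂_a(D_b) = δ_{ab}·1` and satisfying the `ν_a`-twisted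
Leibniz rule `∂_a(p·q) = ∂_a(p)·q + ν_a(p)·∂_a(q)`. -/
theorem existsUnique_partial (hN : 3 ≤ N) (hG0 : G ≠ 0) (hGΛ : G ≠ Λ) :
    ∀ a : Fin N, ∀ ν : Diff k N i0 Λ x G →ₐ[k] Diff k N i0 Λ x G,
      IsNu k N i0 Λ x G a ν →
      ∃! pd : Diff k N i0 Λ x G →ₗ[k] Diff k N i0 Λ x G,
        IsPartial k N i0 Λ x G a ν pd := by
  intro a ν hν
  obtain ⟨φ, hφ⟩ := exists_hom k N i0 Λ x G hG0 hGΛ a ν hν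
  have key : ∀ p, φ p 0 0 = ν p ∧ φ p 1 0 = 0 ∧ φ p 1 1 = p := by
    apply diff_induction
    · intro r
      simp [AlgHom.commutes, Matrix.algebraMap_matrix_apply]
    · intro i
      simp [hφ, mat]
    · rintro p q ⟨h1, h2, h3⟩ ⟨h4, h5, h6⟩
      simp [Matrix.mul_apply, Fin.sum_univ_two, h1, h2, h3, h4, h5, h6]
    · rintro p q ⟨h1, h2, h3⟩ ⟨h4, h5, h6⟩
      simp [h1, h2, h3, h4, h5, h6]
  refine ⟨{ toFun := fun p => φ p 0 1
            map_add' := fun p q => by simp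
            map_smul' := fun r p => by simp }, ⟨?_, ?_⟩, ?_⟩
  · intro b
    simp [hφ, mat]
  · intro p q
    simp only [LinearMap.coe_mk, AddHom.coe_mk, map_mul, Matrix.mul_apply, Fin.sum_univ_two]
    rw [(key p).1, (key q).2.2, add_comm]
  · rintro pd ⟨hb, hl⟩
    have h1 : pd 1 = 0 := by
      have := hl 1 1
      simpa using this
    apply LinearMap.ext
    apply diff_induction
    · intro r
      rw [Algebra.algebraMap_eq_smul_one, map_smul, map_smul, h1]
      simp
    · intro i
      rw [hb]
      simp [hφ, mat]
    · intro p q hp hq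
      rw [hl, hp, hq]
      simp only [LinearMap.coe_mk, AddHom.coe_mk, map_mul, Matrix.mul_apply, Fin.sum_univ_two]
      rw [(key p).1, (key q).2.2, add_comm]
    · intro p q hp hq
      rw [map_add, map_add, hp, hq]

end DiffusionC
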